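/- Let q be a prime power and S a surface of degree d in P^3 over F_q without F_q-plane components, with 2 ≤ d ≤ q+1 and N_q(S) = (d-1)q^2 + dq + 1. Then for every F_q-line l in P^3, the number of F_q-points of l lying on S is 0, 1, d, or q+1. -/

import Mathlib

open MvPolynomial

variable {K : Type} [Field K]

/-- The linear form `∑ aᵢ Xᵢ` as a multivariate polynomial. -/
noncomputable def linForm {n : ℕ} (a : Fin n → K) : MvPolynomial (Fin n) K :=
  ∑ i, C (a i) * X i

/-- The linear form `v ↦ ∑ aᵢ vᵢ` as a linear map. -/
noncomputable def linMap {n : ℕ} (a : Fin n → K) : (Fin n → K) →ₗ[K] K :=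
  ∑ i, a i • LinearMap.proj i

/-- Substitution `F(M·X)` of a linear change of variables into `F`. -/
noncomputable def substLin {n : ℕ} (M : Matrix (Fin n) (Fin n) K)
    (F : MvPolynomial (Fin n) K) : MvPolynomial (Fin n) K :=
  MvPolynomial.aeval (fun i => ∑ j, C (M i j) * X j) F

/-- Projective equivalence over `K` of two forms. -/
def ProjEquiv {n : ℕ} (F G : MvPolynomial (Fin n) K) : Prop :=
  ∃ M : Matrix (Fin n) (Fin n) K, IsUnit M.det ∧
    ∃ c : K, c ≠ 0 ∧ substLin M F = C c * G

/-- An `F_q`-line in `P^3` (resp. `P^2`), as a 2-dimensional linear subspace. -/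
def IsLine {n : ℕ} (W : Submodule K (Fin n → K)) : Prop := Module.finrank K W = 2

/-- An `F_q`-plane in `P^3`, as a 3-dimensional linear subspace. -/
def IsPlane (W : Submodule K (Fin 4 → K)) : Prop := Module.finrank K W = 3

/-- The section `S ∩ H` of the surface `S = {F = 0}` with the plane `H` given by the
subspace `W` is a planar `F_q`-pencil of degree `d` with vertex `P`: modulo the linear
form defining `H`, `F` is a nonzero scalar times a product of `d` linear forms over `F_q`
cutting out `d` pairwise distinct lines of `H`, all passing through the point `P`. -/
def IsPencil (F : MvPolynomial (Fin 4) K) (d : ℕ)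
    (W : Submodule K (Fin 4 → K)) (P : Projectivization K (Fin 4 → K)) : Prop :=
  ∃ (a : Fin 4 → K) (m : Fin d → Fin 4 → K) (c : K) (g : MvPolynomial (Fin 4) K),
    a ≠ 0 ∧ W = LinearMap.ker (linMap a) ∧ c ≠ 0 ∧
    F = C c * (∏ i, linForm (m i)) + linForm a * g ∧
    (∀ i, IsLine (LinearMap.ker (linMap a) ⊓ LinearMap.ker (linMap (m i)))) ∧
    (∀ i j, i ≠ j →
      LinearMap.ker (linMap a) ⊓ LinearMap.ker (linMap (m i)) ≠
      LinearMap.ker (linMap a) ⊓ LinearMap.ker (linMap (m j))) ∧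
    P.rep ∈ W ∧ (∀ i, linMap (m i) P.rep = 0)

/-- The restriction of `F` to the plane `H` given by the subspace `W` has a linear
factor over `F_q` (i.e. the section `S ∩ H` has an `F_q`-line component). -/
def SectionHasLineComp (F : MvPolynomial (Fin 4) K)
    (W : Submodule K (Fin 4 → K)) : Prop :=
  ∃ (a b : Fin 4 → K) (h g : MvPolynomial (Fin 4) K),
    a ≠ 0 ∧ W = LinearMap.ker (linMap a) ∧
    IsLine (LinearMap.ker (linMap a) ⊓ LinearMap.ker (linMap b)) ∧
    F = linForm b * h + linForm a * g

lemma eval_linForm {n : ℕ} (a v : Fin n → K) : eval v (linForm a) = linMap a v := by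
  simp [linForm, linMap]

lemma isHomogeneous_linForm {n : ℕ} (a : Fin n → K) : (linForm a).IsHomogeneous 1 :=
  IsHomogeneous.sum _ _ _ fun i _ => by
    simpa using (isHomogeneous_C (Fin n) (a i)).mul (isHomogeneous_X K i)

lemma linMap_single {n : ℕ} (a : Fin n → K) (i : Fin n) : linMap a (Pi.single i 1) = a i := by
  simp [linMap, Pi.single_apply]

lemma eval_aeval {m n : ℕ} (g : Fin n → MvPolynomial (Fin m) K) (v : Fin m → K)
    (F : MvPolynomial (Fin n) K) :
    eval v (aeval g F) = eval (fun j => eval v (g j)) F := by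
  induction F using MvPolynomial.induction_on <;> simp_all

lemma linForm_ne_zero {n : ℕ} {a : Fin n → K} (ha : a ≠ 0) : linForm a ≠ 0 := by
  intro h
  apply ha
  ext i
  rw [← linMap_single a i, ← eval_linForm, h]
  simp

lemma exists_linMap_eq {n : ℕ} (f : (Fin n → K) →ₗ[K] K) : ∃ a, linMap a = f := by
  refine ⟨fun i => f (Pi.single i 1), ?_⟩
  refine LinearMap.pi_ext' fun i => LinearMap.ext_ring ?_
  simpa using linMap_single _ i

lemma irreducible_linForm {n : ℕ} {a : Fin n → K} (ha : a ≠ 0) : Irreducible (linForm a) := by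
  refine irreducible_of_totalDegree_eq_one
    ((isHomogeneous_linForm a).totalDegree (linForm_ne_zero ha)) fun x hx => ?_
  obtain ⟨m, hm⟩ := MvPolynomial.ne_zero_iff.1 (linForm_ne_zero ha)
  exact isUnit_of_dvd_unit (hx m) (isUnit_iff_ne_zero.2 hm)

/-- A form of degree at most `q` vanishing at all rational points is zero. -/
lemma eq_zero_of_eval_eq_zero_of_le [Fintype K] {n d : ℕ} {G : MvPolynomial (Fin n) K}
    (hG : G.IsHomogeneous d) (hd : d ≤ Fintype.card K) (h : ∀ v, eval v G = 0) : G = 0 :=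
  hG.eq_zero_of_forall_eval_eq_zero_of_le_card h (by simpa using hd)

/-- A form of degree at most `q` vanishing at all rational points of a hyperplane is divisible
by the equation of the hyperplane. -/
lemma linForm_dvd_of_vanishes [Fintype K] {n d : ℕ} {G : MvPolynomial (Fin n) K}
    (hG : G.IsHomogeneous d) (hd : d ≤ Fintype.card K) {a : Fin n → K} (ha : a ≠ 0)
    (h : ∀ v, linMap a v = 0 → eval v G = 0) : linForm a ∣ G := by
  obtain ⟨i, hi⟩ := Function.ne_iff.1 ha
  simp only [Pi.zero_apply] at hi
  let u : Fin n → K := Pi.single i (a i)⁻¹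
  have hu : linMap a u = 1 := by
    have : u = (a i)⁻¹ • Pi.single i 1 := by
      rw [← Pi.single_smul]; simp [u]
    rw [this, map_smul, linMap_single]
    simp [hi]
  let φ : Fin n → MvPolynomial (Fin n) K :=
    fun j => X j - C (u j) * linForm a
  have hφ : ∀ j, (φ j).IsHomogeneous 1 := fun j =>
    (isHomogeneous_X K j).sub (by
      simpa using (isHomogeneous_C (Fin n) (u j)).mul
        (isHomogeneous_linForm a))
  have h0 : aeval φ G = 0 := by
    refine eq_zero_of_eval_eq_zero_of_le (d := d) (by simpa only [one_mul] using hG.aeval φ hφ) hd fun v => ?_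
    rw [eval_aeval]
    apply h
    have : (fun j => eval v (φ j)) = v - linMap a v • u := by
      ext j
      simp [φ, eval_linForm, mul_comm]
    simp [this, hu]
  have h1 : (Ideal.Quotient.mkₐ K (Ideal.span {linForm a})) (aeval φ G) =
      Ideal.Quotient.mkₐ K (Ideal.span {linForm a}) G := by
    conv_rhs => rw [← aeval_X_left_apply G]
    rw [MvPolynomial.comp_aeval_apply, MvPolynomial.comp_aeval_apply]
    congr 2
    ext j
    simp only [φ, Ideal.Quotient.mkₐ_eq_mk]
    rw [Ideal.Quotient.mk_eq_mk_iff_sub_mem, Ideal.mem_span_singleton]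
    exact ⟨-C (u j), by ring⟩
  rw [h0, map_zero, Ideal.Quotient.mkₐ_eq_mk, eq_comm, Ideal.Quotient.eq_zero_iff_mem,
    Ideal.mem_span_singleton] at h1
  exact h1

lemma exists_ker_linMap_eq {n : ℕ} {U : Submodule K (Fin n → K)}
    (hU : Module.finrank K U + 1 = n) : ∃ a, a ≠ 0 ∧ LinearMap.ker (linMap a) = U := by
  have hlt : U < ⊤ := by
    rw [lt_top_iff_ne_top]
    rintro rfl
    simp at hU
  obtain ⟨f, hf0, hf⟩ := U.exists_le_ker_of_lt_top hlt
  obtain ⟨a, rfl⟩ := exists_linMap_eq f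
  refine ⟨a, ?_, (Submodule.eq_of_le_of_finrank_eq hf ?_).symm⟩
  · rintro rfl
    exact hf0 (by simp [linMap])
  · have := Module.Dual.finrank_ker_add_one_of_ne_zero hf0
    simp only [Module.finrank_fin_fun] at this
    omega

lemma isRelPrime_linForm {n : ℕ} {a b : Fin n → K} (ha : a ≠ 0) (hb : b ≠ 0)
    (h : LinearMap.ker (linMap a) ≠ LinearMap.ker (linMap b)) :
    IsRelPrime (linForm a) (linForm b) := by
  rw [(irreducible_linForm ha).isRelPrime_iff_not_dvd]
  intro hab
  have hass := (irreducible_linForm ha).associated_of_dvd (irreducible_linForm hb) hab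
  apply h
  ext v
  simp only [LinearMap.mem_ker, ← eval_linForm]
  exact (hass.map (eval v)).eq_zero_iff

/-- A nonzero form of degree `d ≤ q` vanishes at all rational points of at most `d`
hyperplanes. -/
lemma card_hyperplanes_le [Fintype K] {n d : ℕ} {G : MvPolynomial (Fin n) K}
    (hG : G.IsHomogeneous d) (hd : d ≤ Fintype.card K) (hG0 : G ≠ 0)
    (s : Finset (Submodule K (Fin n → K)))
    (hs : ∀ U ∈ s, Module.finrank K U + 1 = n ∧ ∀ v ∈ U, eval v G = 0) : s.card ≤ d := by
  have hex : ∀ U : Submodule K (Fin n → K), ∃ a, U ∈ s → a ≠ 0 ∧ LinearMap.ker (linMap a) = U := by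
    intro U
    by_cases hU : U ∈ s
    · obtain ⟨a, ha⟩ := exists_ker_linMap_eq (hs U hU).1
      exact ⟨a, fun _ => ha⟩
    · exact ⟨0, fun h => absurd h hU⟩
  choose a ha using hex
  have hdvd : ∏ U ∈ s, linForm (a U) ∣ G := by
    refine Finset.prod_dvd_of_isRelPrime (fun U hU V hV hUV => ?_) fun U hU => ?_
    · refine isRelPrime_linForm (ha U hU).1 (ha V hV).1 ?_
      rwa [(ha U hU).2, (ha V hV).2]
    · refine linForm_dvd_of_vanishes hG hd (ha U hU).1 fun v hv => (hs U hU).2 v ?_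
      rw [← (ha U hU).2]
      exact hv
  obtain ⟨H, hH⟩ := hdvd
  have hH0 : H ≠ 0 := by rintro rfl; simp at hH; exact hG0 hH
  have hP0 : ∏ U ∈ s, linForm (a U) ≠ 0 :=
    Finset.prod_ne_zero_iff.2 fun U hU => linForm_ne_zero (ha U hU).1
  have hPd := (IsHomogeneous.prod s (fun U => linForm (a U)) (fun _ => 1)
    fun U _ => isHomogeneous_linForm _).totalDegree hP0
  have := totalDegree_mul_of_isDomain hP0 hH0
  rw [← hH, hG.totalDegree hG0, hPd] at this
  simp at this
  omega

/-- A form of degree `d ≤ q` not vanishing on all rational points of a linear subspace `W`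
vanishes on at most `d` hyperplanes of `W`. -/
lemma card_hyperplanes_of_submodule_le [Fintype K] {n d : ℕ} {F : MvPolynomial (Fin n) K}
    (hF : F.IsHomogeneous d) (hd : d ≤ Fintype.card K) (W : Submodule K (Fin n → K))
    (hW : ∃ v ∈ W, eval v F ≠ 0) (s : Finset (Submodule K (Fin n → K)))
    (hs : ∀ U ∈ s, U ≤ W ∧ Module.finrank K U + 1 = Module.finrank K W ∧
      ∀ v ∈ U, eval v F = 0) : s.card ≤ d := by
  classical
  let e := (Module.finBasis K W).equivFun.symm
  let T : (Fin (Module.finrank K W) → K) →ₗ[K] (Fin n → K) := W.subtype ∘ₗ e.toLinearMap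
  have hTinj : Function.Injective T := W.injective_subtype.comp e.injective
  have hTrange : LinearMap.range T = W := by
    rw [LinearMap.range_comp_of_range_eq_top _ e.range, Submodule.range_subtype]
  choose b hb using fun i => exists_linMap_eq (LinearMap.proj i ∘ₗ T)
  let G := aeval (fun i => linForm (b i)) F
  have hGe : ∀ v, eval v G = eval (T v) F := by
    intro v
    rw [eval_aeval]
    congr 2
    ext j
    rw [eval_linForm, hb]
    rfl
  have hG0 : G ≠ 0 := by
    rintro h
    obtain ⟨v, hv, hv0⟩ := hW
    rw [← hTrange] at hv
    obtain ⟨w, rfl⟩ := hv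
    rw [← hGe, h] at hv0
    simp at hv0
  have hmap : ∀ U ∈ s, (U.comap T).map T = U := fun U hU => by
    rw [Submodule.map_comap_eq, hTrange]
    exact inf_eq_right.2 (hs U hU).1
  have hinj : Set.InjOn (Submodule.comap T) s := fun U hU V hV h => by
    rw [← hmap U hU, ← hmap V hV, h]
  rw [← Finset.card_image_of_injOn hinj]
  refine card_hyperplanes_le (G := G) (d := d)
    (by simpa only [one_mul] using hF.aeval _ fun i => isHomogeneous_linForm (b i)) hd hG0 _ fun U' hU' => ?_
  obtain ⟨U, hU, rfl⟩ := Finset.mem_image.1 hU'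
  refine ⟨?_, fun v hv => ?_⟩
  · have := ((U.comap T).equivMapOfInjective T hTinj).finrank_eq
    rw [hmap U hU] at this
    rw [this, (hs U hU).2.1]
  · rw [hGe]
    exact (hs U hU).2.2 _ hv

section Counting

open Finset Module

/-- The rational points of a linear subspace. -/
noncomputable def ratPoints [Finite K] {n : ℕ} (U : Submodule K (Fin n → K)) :
    Finset (Projectivization K (Fin n → K)) :=
  (Set.toFinite {p : Projectivization K (Fin n → K) | p.rep ∈ U}).toFinset

/-- The `(dim U + 1)`-dimensional subspaces between `U` and `W`. -/
noncomputable def coversIn [Finite K] {n : ℕ} (U W : Submodule K (Fin n → K)) :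
    Finset (Submodule K (Fin n → K)) :=
  (Set.toFinite {L | U ≤ L ∧ L ≤ W ∧ finrank K L = finrank K U + 1}).toFinset

/-- The lines in `W` all of whose rational points are in `S`. -/
noncomputable def linesInside [Finite K] {n : ℕ} (S : Finset (Projectivization K (Fin n → K)))
    (W : Submodule K (Fin n → K)) : Finset (Submodule K (Fin n → K)) :=
  (Set.toFinite {L | L ≤ W ∧ IsLine L ∧ ratPoints L ⊆ S}).toFinset

open scoped Classical

variable [Finite K] {n : ℕ} {U W L M : Submodule K (Fin n → K)}
  {p r : Projectivization K (Fin n → K)} {S : Finset (Projectivization K (Fin n → K))}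

lemma mem_ratPoints : p ∈ ratPoints U ↔ p.rep ∈ U := by simp [ratPoints]

lemma mem_ratPoints_iff_submodule_le : p ∈ ratPoints U ↔ p.submodule ≤ U := by
  rw [mem_ratPoints, Projectivization.submodule_eq, Submodule.span_singleton_le_iff_mem]

lemma mem_coversIn :
    L ∈ coversIn U W ↔ U ≤ L ∧ L ≤ W ∧ finrank K L = finrank K U + 1 := by simp [coversIn]

lemma mem_linesInside : L ∈ linesInside S W ↔ L ≤ W ∧ IsLine L ∧ ratPoints L ⊆ S := by
  simp [linesInside]

lemma ratPoints_mono (h : U ≤ W) : ratPoints U ⊆ ratPoints W := fun p hp => by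
  rw [mem_ratPoints] at *
  exact h hp

lemma mem_ratPoints_inf : p ∈ ratPoints (U ⊓ W) ↔ p ∈ ratPoints U ∧ p ∈ ratPoints W := by
  simp [mem_ratPoints]

lemma card_ratPoints (U : Submodule K (Fin n → K)) :
    #(ratPoints U) = ∑ i ∈ range (finrank K U), Nat.card K ^ i := by
  rw [← Projectivization.card_of_finrank K U rfl, ratPoints, ← Nat.card_eq_card_finite_toFinset]
  have hinj := Projectivization.map_injective U.subtype U.injective_subtype
  have hmem : ∀ p, (Projectivization.map U.subtype U.injective_subtype p).rep ∈ U := by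
    intro p
    induction p with | h v hv =>
    obtain ⟨a, ha⟩ := Projectivization.exists_smul_eq_mk_rep K (v : Fin n → K) (by simpa using hv)
    rw [Projectivization.map_mk]
    simp only [Submodule.subtype_apply]
    rw [← ha]
    exact U.smul_mem _ v.2
  refine (Nat.card_congr (Equiv.ofBijective (fun p =>
    ⟨Projectivization.map U.subtype U.injective_subtype p, hmem p⟩) ⟨?_, ?_⟩)).symm
  · intro p r h
    exact hinj (congrArg Subtype.val h)
  · rintro ⟨p, hp⟩
    refine ⟨Projectivization.mk K ⟨p.rep, hp⟩ (by simpa using p.rep_nonzero), ?_⟩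
    rw [Subtype.mk.injEq]
    rw [Projectivization.map_mk]
    exact p.mk_rep

lemma exists_mem_ratPoints (h : finrank K U ≠ 0) : ∃ p, p ∈ ratPoints U := by
  rw [← Finset.Nonempty, ← card_pos, card_ratPoints]
  obtain ⟨k, hk⟩ := Nat.exists_eq_succ_of_ne_zero h
  simp [hk, sum_range_succ']

lemma card_ratPoints_line (h : IsLine U) : #(ratPoints U) = Nat.card K + 1 := by
  rw [card_ratPoints, h]
  simp [sum_range_succ, add_comm]

lemma line_eq_of_mem (hL : IsLine L) (hM : IsLine M) (hpr : p ≠ r)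
    (hpL : p ∈ ratPoints L) (hpM : p ∈ ratPoints M)
    (hrL : r ∈ ratPoints L) (hrM : r ∈ ratPoints M) : L = M := by
  have h1 : 1 < #(ratPoints (L ⊓ M)) := one_lt_card.2
    ⟨p, mem_ratPoints_inf.2 ⟨hpL, hpM⟩, r, mem_ratPoints_inf.2 ⟨hrL, hrM⟩, hpr⟩
  have h2 : 2 ≤ finrank K ↥(L ⊓ M) := by
    by_contra h
    rw [card_ratPoints] at h1
    have : finrank K ↥(L ⊓ M) = 0 ∨ finrank K ↥(L ⊓ M) = 1 := by omega
    rcases this with h | h <;> simp [h] at h1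
  rw [← Submodule.eq_of_le_of_finrank_le inf_le_left (hL.trans_le h2),
    Submodule.eq_of_le_of_finrank_le (inf_le_right : L ⊓ M ≤ M) (hM.trans_le h2)]

lemma exists_mem_ratPoints_of_lines (hL : IsLine L) (hM : IsLine M)
    (hW : finrank K W = 3) (hLW : L ≤ W) (hMW : M ≤ W) :
    ∃ p, p ∈ ratPoints L ∧ p ∈ ratPoints M := by
  have h1 := Submodule.finrank_sup_add_finrank_inf_eq L M
  have h2 := Submodule.finrank_mono (sup_le hLW hMW)
  rw [IsLine] at hL hM
  obtain ⟨p, hp⟩ := exists_mem_ratPoints (U := L ⊓ M) (by omega)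
  exact ⟨p, mem_ratPoints_inf.1 hp⟩

/-- Counting the points of `S` in `W` according to the subspaces covering `U`. -/
lemma card_inter_add_card_coversIn_mul (S : Finset (Projectivization K (Fin n → K))) (h : U ≤ W) :
    #(S ∩ ratPoints W) + #(coversIn U W) * #(S ∩ ratPoints U) =
      #(S ∩ ratPoints U) + ∑ L ∈ coversIn U W, #(S ∩ ratPoints L) := by
  have key : #((S ∩ ratPoints W) \ (S ∩ ratPoints U)) =
      ∑ L ∈ coversIn U W, #((S ∩ ratPoints L) \ (S ∩ ratPoints U)) := by
    rw [card_eq_sum_card_fiberwise (f := fun p => U ⊔ p.submodule) (t := coversIn U W)]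
    · refine sum_congr rfl fun L hL => ?_
      rw [mem_coversIn] at hL
      congr 1
      ext p
      simp only [mem_filter, mem_sdiff, mem_inter, not_and, mem_ratPoints_iff_submodule_le]
      constructor
      · rintro ⟨⟨⟨hpS, hpW⟩, hpU⟩, hpL⟩
        exact ⟨⟨hpS, hpL ▸ le_sup_right⟩, hpU⟩
      · rintro ⟨⟨hpS, hpL⟩, hpU⟩
        refine ⟨⟨⟨hpS, hpL.trans hL.2.1⟩, hpU⟩, ?_⟩
        refine Submodule.eq_of_le_of_finrank_le (sup_le hL.1 hpL) ?_
        rw [hL.2.2]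
        refine Submodule.finrank_lt_finrank_of_lt (lt_of_le_of_ne le_sup_left fun h => ?_)
        exact hpU hpS (h ▸ le_sup_right)
    · intro p hp
      simp only [coe_sdiff, coe_inter, Set.mem_sdiff, Set.mem_inter_iff, mem_coe, not_and,
        mem_ratPoints_iff_submodule_le] at hp
      simp only [mem_coe, mem_coversIn]
      refine ⟨le_sup_left, sup_le h hp.1.2, le_antisymm ?_ ?_⟩
      · exact (Submodule.finrank_add_le_finrank_add_finrank U p.submodule).trans_eq
          (by rw [p.finrank_submodule])
      · refine Submodule.finrank_lt_finrank_of_lt (lt_of_le_of_ne le_sup_left fun h => ?_)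
        exact hp.2 hp.1.1 (h ▸ le_sup_right)
  have h1 := card_sdiff_add_card_eq_card (inter_subset_inter (Subset.refl S) (ratPoints_mono h))
  rw [← h1, key, ← smul_eq_mul, ← sum_const, add_right_comm, ← sum_add_distrib, add_comm]
  congr 1
  refine sum_congr rfl fun L hL => ?_
  exact card_sdiff_add_card_eq_card
    (inter_subset_inter (Subset.refl S) (ratPoints_mono (mem_coversIn.1 hL).1))

lemma card_coversIn (h : U ≤ W) :
    ∑ i ∈ range (finrank K W), Nat.card K ^ i =
      ∑ i ∈ range (finrank K U), Nat.card K ^ i + #(coversIn U W) * Nat.card K ^ finrank K U := by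
  have := Fintype.ofFinite (Projectivization K (Fin n → K))
  have h1 := card_inter_add_card_coversIn_mul (S := univ) h
  simp only [univ_inter, card_ratPoints] at h1
  have h2 : ∑ L ∈ coversIn U W, ∑ i ∈ range (finrank K L), Nat.card K ^ i =
      #(coversIn U W) * (∑ i ∈ range (finrank K U), Nat.card K ^ i + Nat.card K ^ finrank K U) := by
    rw [← smul_eq_mul, ← sum_const]
    exact sum_congr rfl fun L hL => by rw [(mem_coversIn.1 hL).2.2, sum_range_succ]
  rw [h2, mul_add] at h1
  omega

lemma card_inter_ratPoints_submodule (hp : p ∈ S) :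
    #(S ∩ ratPoints p.submodule) = 1 := by
  refine le_antisymm ?_ (card_pos.2 ⟨p, mem_inter.2 ⟨hp, mem_ratPoints_iff_submodule_le.2 le_rfl⟩⟩)
  refine (card_le_card inter_subset_right).trans ?_
  rw [card_ratPoints, p.finrank_submodule]
  simp

/-- If no line in `W` through `p` lies inside `S`, and lines not inside `S` have at most `d`
points in `S`, then the pencil of lines through `p` bounds the number of points. -/
lemma card_inter_add_card_coversIn_le {d : ℕ}
    (hS : ∀ L : Submodule K (Fin n → K), IsLine L → ¬ ratPoints L ⊆ S → #(S ∩ ratPoints L) ≤ d)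
    (hp : p ∈ S) (hpW : p ∈ ratPoints W) (hno : ∀ L ∈ linesInside S W, p ∉ ratPoints L) :
    #(S ∩ ratPoints W) + #(coversIn p.submodule W) ≤ 1 + #(coversIn p.submodule W) * d := by
  have h := card_inter_add_card_coversIn_mul S (mem_ratPoints_iff_submodule_le.1 hpW)
  rw [card_inter_ratPoints_submodule hp, mul_one] at h
  rw [h]
  gcongr
  rw [← smul_eq_mul]
  refine sum_le_card_nsmul _ _ _ fun L hL => ?_
  rw [mem_coversIn, p.finrank_submodule] at hL
  exact hS L hL.2.2 fun hLS => hno L (mem_linesInside.2 ⟨hL.2.1, hL.2.2, hLS⟩)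
    (mem_ratPoints_iff_submodule_le.2 hL.1)

lemma card_ratPoints_sdiff_le (hL : IsLine L) (hM : IsLine M) (hW : finrank K W = 3)
    (hLW : L ≤ W) (hMW : M ≤ W) : #(ratPoints M \ ratPoints L) ≤ Nat.card K := by
  obtain ⟨p, hpL, hpM⟩ := exists_mem_ratPoints_of_lines hL hM hW hLW hMW
  have h : ratPoints M \ ratPoints L ⊆ (ratPoints M).erase p := fun r hr => by
    rw [mem_sdiff] at hr
    exact mem_erase.2 ⟨fun h => hr.2 (h ▸ hpL), hr.1⟩
  have := card_le_card h
  rwa [card_erase_of_mem hpM, card_ratPoints_line hM] at this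

/-- If every point of `S` in a plane is on a line inside `S`, then the number of points is bounded
in terms of the number of lines. -/
lemma card_inter_plane_le (hW : finrank K W = 3)
    (hcov : ∀ p ∈ S, p ∈ ratPoints W → ∃ M ∈ linesInside S W, p ∈ ratPoints M)
    (hL : L ∈ linesInside S W) :
    #(S ∩ ratPoints W) ≤ #(linesInside S W) * Nat.card K + 1 := by
  have hsub : S ∩ ratPoints W ⊆ ratPoints L ∪
      ((linesInside S W).erase L).biUnion fun M => ratPoints M \ ratPoints L := by
    intro p hp
    rw [mem_inter] at hp
    obtain ⟨M, hM, hpM⟩ := hcov p hp.1 hp.2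
    by_cases hpL : p ∈ ratPoints L
    · exact mem_union_left _ hpL
    · exact mem_union_right _ (mem_biUnion.2
        ⟨M, mem_erase.2 ⟨fun h => hpL (h ▸ hpM), hM⟩, mem_sdiff.2 ⟨hpM, hpL⟩⟩)
  have hL' := mem_linesInside.1 hL
  have h1 := (card_le_card hsub).trans (card_union_le _ _)
  have h2 := card_biUnion_le_card_mul ((linesInside S W).erase L)
    (fun M => ratPoints M \ ratPoints L) (Nat.card K) fun M hM => by
      have hM' := mem_linesInside.1 (mem_of_mem_erase hM)
      exact card_ratPoints_sdiff_le hL'.2.1 hM'.2.1 hW hL'.1 hM'.1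
  rw [card_ratPoints_line hL'.2.1] at h1
  rw [← card_erase_add_one hL, add_mul]
  omega

/-- In the equality case of `card_inter_plane_le` the lines inside `S` are concurrent. -/
lemma mem_ratPoints_of_card_inter_plane {A B : Submodule K (Fin n → K)} (hW : finrank K W = 3)
    (hcov : ∀ p ∈ S, p ∈ ratPoints W → ∃ M ∈ linesInside S W, p ∈ ratPoints M)
    (hcard : #(S ∩ ratPoints W) = #(linesInside S W) * Nat.card K + 1)
    (hA : A ∈ linesInside S W) (hB : B ∈ linesInside S W) (hAB : A ≠ B)
    (hpA : p ∈ ratPoints A) (hpB : p ∈ ratPoints B) (hL : L ∈ linesInside S W) :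
    p ∈ ratPoints L := by
  by_contra hpL
  have hLB : B ≠ L := fun h => hpL (h ▸ hpB)
  have hLA : A ≠ L := fun h => hpL (h ▸ hpA)
  have hBe : B ∈ (linesInside S W).erase L := mem_erase.2 ⟨hLB, hB⟩
  have hAe : A ∈ ((linesInside S W).erase L).erase B := mem_erase.2 ⟨hAB, mem_erase.2 ⟨hLA, hA⟩⟩
  have hsub : S ∩ ratPoints W ⊆ ratPoints L ∪
      ((ratPoints B \ ratPoints L).erase p ∪
      (((linesInside S W).erase L).erase B).biUnion fun M => ratPoints M \ ratPoints L) := by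
    intro r hr
    rw [mem_inter] at hr
    obtain ⟨M, hM, hrM⟩ := hcov r hr.1 hr.2
    by_cases hrL : r ∈ ratPoints L
    · exact mem_union_left _ hrL
    refine mem_union_right _ ?_
    have hML : M ≠ L := fun h => hrL (h ▸ hrM)
    by_cases hrp : r = p
    · subst hrp
      exact mem_union_right _ (mem_biUnion.2 ⟨A, hAe, mem_sdiff.2 ⟨hpA, hrL⟩⟩)
    by_cases hMB : M = B
    · subst hMB
      exact mem_union_left _ (mem_erase.2 ⟨hrp, mem_sdiff.2 ⟨hrM, hrL⟩⟩)
    · exact mem_union_right _ (mem_biUnion.2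
        ⟨M, mem_erase.2 ⟨hMB, mem_erase.2 ⟨hML, hM⟩⟩, mem_sdiff.2 ⟨hrM, hrL⟩⟩)
  have hL' := mem_linesInside.1 hL
  have hdiff : ∀ M ∈ linesInside S W, #(ratPoints M \ ratPoints L) ≤ Nat.card K := fun M hM => by
    have hM' := mem_linesInside.1 hM
    exact card_ratPoints_sdiff_le hL'.2.1 hM'.2.1 hW hL'.1 hM'.1
  have h1 := (card_le_card hsub).trans (card_union_le _ _)
  have h2 := card_biUnion_le_card_mul (((linesInside S W).erase L).erase B)
    (fun M => ratPoints M \ ratPoints L) (Nat.card K) fun M hM =>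
      hdiff M (mem_of_mem_erase (mem_of_mem_erase hM))
  have h3 := card_union_le ((ratPoints B \ ratPoints L).erase p)
    ((((linesInside S W).erase L).erase B).biUnion fun M => ratPoints M \ ratPoints L)
  have h4 := card_erase_add_one (mem_sdiff.2 ⟨hpB, hpL⟩)
  have h5 := hdiff B hB
  rw [card_ratPoints_line hL'.2.1] at h1
  rw [hcard, ← card_erase_add_one hL, ← card_erase_add_one hBe, add_mul, add_mul] at h1
  omega

/-- A line not inside `S` in a plane attaining the bound meets `S` in `0`, `1` or at least as many
points as there are lines inside `S`. -/
lemma card_inter_line_of_card_inter_plane (hW : finrank K W = 3)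
    (hcov : ∀ p ∈ S, p ∈ ratPoints W → ∃ M ∈ linesInside S W, p ∈ ratPoints M)
    (hcard : #(S ∩ ratPoints W) = #(linesInside S W) * Nat.card K + 1)
    (hL : IsLine L) (hLW : L ≤ W) (hLS : ¬ ratPoints L ⊆ S) :
    #(S ∩ ratPoints L) ≤ 1 ∨ #(linesInside S W) ≤ #(S ∩ ratPoints L) := by
  have hex : ∀ M, ∃ p, M ∈ linesInside S W → p ∈ ratPoints L ∧ p ∈ ratPoints M := by
    intro M
    by_cases hM : M ∈ linesInside S W
    · have hM' := mem_linesInside.1 hM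
      obtain ⟨p, hp⟩ := exists_mem_ratPoints_of_lines hL hM'.2.1 hW hLW hM'.1
      exact ⟨p, fun _ => hp⟩
    · obtain ⟨p, -⟩ := exists_mem_ratPoints (U := L) (by rw [hL]; simp)
      exact ⟨p, fun h => absurd h hM⟩
  choose f hf using hex
  by_cases hinj : Set.InjOn f (linesInside S W)
  · right
    refine card_le_card_of_injOn f (fun M hM => ?_) hinj
    have := hf M hM
    exact mem_inter.2 ⟨(mem_linesInside.1 hM).2.2 this.2, this.1⟩
  · left
    simp only [Set.InjOn, mem_coe, not_forall] at hinj
    obtain ⟨A, hA, B, hB, hfAB, hAB⟩ := hinj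
    have hall : ∀ M ∈ linesInside S W, f A ∈ ratPoints M := fun M hM =>
      mem_ratPoints_of_card_inter_plane hW hcov hcard hA hB hAB (hf A hA).2
        (hfAB ▸ (hf B hB).2) hM
    have hsub : S ∩ ratPoints L ⊆ {f A} := by
      intro r hr
      rw [mem_inter] at hr
      rw [mem_singleton]
      by_contra hne
      obtain ⟨M, hM, hrM⟩ := hcov r hr.1 (ratPoints_mono hLW hr.2)
      have hM' := mem_linesInside.1 hM
      exact hLS (line_eq_of_mem hL hM'.2.1 hne hr.2 hrM (hf A hA).1 (hall M hM) ▸ hM'.2.2)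
    simpa using card_le_card hsub

lemma exists_linesInside_of_card_plane {e : ℕ}
    (hS : ∀ L : Submodule K (Fin n → K), IsLine L → ¬ ratPoints L ⊆ S → #(S ∩ ratPoints L) ≤ e + 1)
    (he : e < Nat.card K) (hW : finrank K W = 3)
    (hcard : (e + 1) * Nat.card K + 1 ≤ #(S ∩ ratPoints W)) (hp : p ∈ S) (hpW : p ∈ ratPoints W) :
    ∃ M ∈ linesInside S W, p ∈ ratPoints M := by
  by_contra! hno
  have h1 := card_inter_add_card_coversIn_le hS hp hpW hno
  have h2 := card_coversIn (mem_ratPoints_iff_submodule_le.1 hpW)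
  rw [hW, p.finrank_submodule] at h2
  simp only [sum_range_succ, range_zero, sum_empty, pow_zero, pow_one, zero_add] at h2
  have h3 : #(coversIn p.submodule W) = Nat.card K + 1 := by
    refine Nat.eq_of_mul_eq_mul_right Nat.card_pos (m := Nat.card K) ?_
    linarith
  rw [h3] at h1
  nlinarith

lemma card_inter_plane_le_of_linesInside {e : ℕ}
    (hS : ∀ L : Submodule K (Fin n → K), IsLine L → ¬ ratPoints L ⊆ S → #(S ∩ ratPoints L) ≤ e + 1)
    (he : e < Nat.card K) (hW : finrank K W = 3) (hlines : #(linesInside S W) ≤ e + 1)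
    (hL : L ∈ linesInside S W) : #(S ∩ ratPoints W) ≤ (e + 1) * Nat.card K + 1 := by
  by_contra! h
  have := card_inter_plane_le hW
    (fun p hp hpW => exists_linesInside_of_card_plane hS he hW h.le hp hpW) hL
  have := Nat.mul_le_mul_right (Nat.card K) hlines
  omega

lemma exists_linesInside_of_card {e : ℕ}
    (hS : ∀ L : Submodule K (Fin n → K), IsLine L → ¬ ratPoints L ⊆ S → #(S ∩ ratPoints L) ≤ e + 1)
    (he : e < Nat.card K) (hn : n = 4)
    (hcard : #S = e * Nat.card K ^ 2 + (e + 1) * Nat.card K + 1) (hp : p ∈ S) :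
    ∃ M ∈ linesInside S ⊤, p ∈ ratPoints M := by
  by_contra! hno
  have h1 := card_inter_add_card_coversIn_le hS hp (W := ⊤) (by simp [mem_ratPoints]) hno
  have h0 : S ∩ ratPoints ⊤ = S := inter_eq_left.2 fun p _ => by simp [mem_ratPoints]
  have h2 := card_coversIn (le_top (a := p.submodule))
  have h4 : finrank K (⊤ : Submodule K (Fin n → K)) = 4 := by simpa using hn
  rw [h4, p.finrank_submodule] at h2
  simp only [sum_range_succ, range_zero, sum_empty, pow_zero, pow_one, zero_add] at h2
  have h3 : #(coversIn p.submodule ⊤) = Nat.card K ^ 2 + Nat.card K + 1 := by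
    refine Nat.eq_of_mul_eq_mul_right Nat.card_pos (m := Nat.card K) ?_
    linarith
  rw [h3, h0, hcard] at h1
  nlinarith

lemma card_inter_plane_eq_of_linesInside {e : ℕ}
    (hS : ∀ L : Submodule K (Fin n → K), IsLine L → ¬ ratPoints L ⊆ S → #(S ∩ ratPoints L) ≤ e + 1)
    (hP : ∀ W : Submodule K (Fin n → K), finrank K W = 3 → #(linesInside S W) ≤ e + 1)
    (he : e < Nat.card K) (hn : n = 4)
    (hcard : #S = e * Nat.card K ^ 2 + (e + 1) * Nat.card K + 1)
    (hW : finrank K W = 3) (hL : L ∈ linesInside S W) :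
    #(S ∩ ratPoints W) = (e + 1) * Nat.card K + 1 := by
  obtain ⟨hLW, hLl, hLS⟩ := mem_linesInside.1 hL
  have h1 := card_inter_add_card_coversIn_mul S (le_top (a := L))
  have h0 : S ∩ ratPoints ⊤ = S := inter_eq_left.2 fun p _ => by simp [mem_ratPoints]
  have h2 := card_coversIn (le_top (a := L))
  have hLl' : finrank K L = 2 := hLl
  have h4 : finrank K (⊤ : Submodule K (Fin n → K)) = 4 := by simpa using hn
  rw [h4, hLl'] at h2
  simp only [sum_range_succ, range_zero, sum_empty, pow_zero, pow_one, zero_add] at h2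
  have h3 : #(coversIn L ⊤) = Nat.card K + 1 := by
    refine Nat.eq_of_mul_eq_mul_right (pow_pos Nat.card_pos 2) (m := Nat.card K ^ 2) ?_
    linarith
  rw [h0, h3, hcard, inter_eq_right.2 hLS, card_ratPoints_line hLl] at h1
  have hle : ∀ H ∈ coversIn L ⊤, #(S ∩ ratPoints H) ≤ (e + 1) * Nat.card K + 1 := fun H hH => by
    obtain ⟨hLH, -, hH3⟩ := mem_coversIn.1 hH
    rw [hLl'] at hH3
    exact card_inter_plane_le_of_linesInside hS he hH3 (hP H hH3)
      (mem_linesInside.2 ⟨hLH, hLl, hLS⟩)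
  refine (sum_eq_sum_iff_of_le hle).1 ?_ W (mem_coversIn.2 ⟨hLW, le_top, by rw [hW, hLl']⟩)
  rw [sum_const, h3, smul_eq_mul]
  linarith

/-- Combinatorial core: the intersection numbers of lines with a point set attaining the
elementary bound. -/
lemma card_inter_line_of_card {e : ℕ}
    (hS : ∀ L : Submodule K (Fin n → K), IsLine L → ¬ ratPoints L ⊆ S → #(S ∩ ratPoints L) ≤ e + 1)
    (hP : ∀ W : Submodule K (Fin n → K), finrank K W = 3 → #(linesInside S W) ≤ e + 1)
    (he : e < Nat.card K) (hn : n = 4)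
    (hcard : #S = e * Nat.card K ^ 2 + (e + 1) * Nat.card K + 1) (hL : IsLine L) :
    #(S ∩ ratPoints L) = 0 ∨ #(S ∩ ratPoints L) = 1 ∨ #(S ∩ ratPoints L) = e + 1 ∨
      #(S ∩ ratPoints L) = Nat.card K + 1 := by
  by_cases hLS : ratPoints L ⊆ S
  · rw [inter_eq_right.2 hLS, card_ratPoints_line hL]
    simp
  obtain h0 | ⟨p, hp⟩ := (S ∩ ratPoints L).eq_empty_or_nonempty
  · simp [h0]
  rw [mem_inter] at hp
  obtain ⟨M, hM, hpM⟩ := exists_linesInside_of_card hS he hn hcard hp.1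
  obtain ⟨-, hMl, hMS⟩ := mem_linesInside.1 hM
  have hW : finrank K ↥(L ⊔ M) = 3 := by
    have h1 := Submodule.finrank_sup_add_finrank_inf_eq L M
    have hpi := Submodule.finrank_mono
      (mem_ratPoints_iff_submodule_le.1 (mem_ratPoints_inf.2 ⟨hp.2, hpM⟩))
    rw [p.finrank_submodule] at hpi
    have hlt : L < L ⊔ M := lt_of_le_of_ne le_sup_left fun h => hLS <| by
      have : M = L := Submodule.eq_of_le_of_finrank_eq (h ▸ le_sup_right) (hMl.trans hL.symm)
      exact this ▸ hMS
    have h2 := Submodule.finrank_lt_finrank_of_lt hlt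
    rw [IsLine] at hL hMl
    omega
  have hMW : M ∈ linesInside S (L ⊔ M) := mem_linesInside.2 ⟨le_sup_right, hMl, hMS⟩
  have hc := card_inter_plane_eq_of_linesInside hS hP he hn hcard hW hMW
  have hcov := fun r hr hrW => exists_linesInside_of_card_plane hS he hW hc.ge hr hrW (p := r)
  have hlines : #(linesInside S (L ⊔ M)) = e + 1 := by
    refine le_antisymm (hP _ hW) (Nat.le_of_mul_le_mul_right ?_ (Nat.card_pos (α := K)))
    have := card_inter_plane_le hW hcov hMW
    omega
  have h := card_inter_line_of_card_inter_plane hW hcov (by rw [hc, hlines]) hL le_sup_left hLS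
  have := hS L hL hLS
  omega

end Counting

lemma eval_smul_of_isHomogeneous {n d : ℕ} {F : MvPolynomial (Fin n) K} (hF : F.IsHomogeneous d)
    (c : K) (v : Fin n → K) : eval (c • v) F = c ^ d * eval v F := by
  rw [eval_eq, eval_eq, Finset.mul_sum]
  refine Finset.sum_congr rfl fun m hm => ?_
  rw [hF.degree_eq_sum_deg_support hm, ← Finset.prod_pow_eq_pow_sum]
  simp only [Pi.smul_apply, smul_eq_mul, mul_pow, Finset.prod_mul_distrib]
  ring

/-- The rational points of the projective hypersurface `F = 0`. -/
noncomputable def zeroPoints [Finite K] {n : ℕ} (F : MvPolynomial (Fin n) K) :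
    Finset (Projectivization K (Fin n → K)) :=
  (Set.toFinite {p : Projectivization K (Fin n → K) | eval p.rep F = 0}).toFinset

lemma mem_zeroPoints [Finite K] {n : ℕ} {F : MvPolynomial (Fin n) K}
    {p : Projectivization K (Fin n → K)} : p ∈ zeroPoints F ↔ eval p.rep F = 0 := by
  simp [zeroPoints]

lemma ratPoints_subset_zeroPoints_iff [Finite K] {n d : ℕ} {F : MvPolynomial (Fin n) K}
    (hF : F.IsHomogeneous d) (hd : d ≠ 0) (U : Submodule K (Fin n → K)) :
    ratPoints U ⊆ zeroPoints F ↔ ∀ v ∈ U, eval v F = 0 := by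
  constructor
  · intro h v hv
    by_cases hv0 : v = 0
    · have := eval_smul_of_isHomogeneous hF 0 0
      rwa [zero_smul, zero_pow hd, zero_mul, ← hv0] at this
    · obtain ⟨a, ha⟩ := Projectivization.exists_smul_eq_mk_rep K v hv0
      have hmem : Projectivization.mk K v hv0 ∈ ratPoints U := by
        rw [mem_ratPoints, ← ha]
        exact U.smul_mem _ hv
      have h1 := mem_zeroPoints.1 (h hmem)
      rw [← ha, Units.smul_def, eval_smul_of_isHomogeneous hF] at h1
      exact (mul_eq_zero.1 h1).resolve_left (pow_ne_zero _ a.ne_zero)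
  · intro h p hp
    exact mem_zeroPoints.2 (h _ (mem_ratPoints.1 hp))

open Classical in
lemma card_zeroPoints_inter_line_le [Fintype K] {n d : ℕ} {F : MvPolynomial (Fin n) K}
    (hF : F.IsHomogeneous d) (hd0 : d ≠ 0) (hd : d ≤ Fintype.card K)
    {L : Submodule K (Fin n → K)} (hL : IsLine L) (hLF : ¬ ratPoints L ⊆ zeroPoints F) :
    (zeroPoints F ∩ ratPoints L).card ≤ d := by
  rw [ratPoints_subset_zeroPoints_iff hF hd0] at hLF
  push Not at hLF
  rw [← Finset.card_image_of_injective _ Projectivization.submodule_injective]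
  refine card_hyperplanes_of_submodule_le hF hd L hLF _ fun U hU => ?_
  obtain ⟨p, hp, rfl⟩ := Finset.mem_image.1 hU
  rw [Finset.mem_inter, mem_zeroPoints, mem_ratPoints_iff_submodule_le] at hp
  refine ⟨hp.2, by rw [p.finrank_submodule, hL], fun v hv => ?_⟩
  rw [Projectivization.submodule_eq, Submodule.mem_span_singleton] at hv
  obtain ⟨c, rfl⟩ := hv
  rw [eval_smul_of_isHomogeneous hF, hp.1, mul_zero]

lemma card_linesInside_zeroPoints_le [Fintype K] {d : ℕ} {F : MvPolynomial (Fin 4) K}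
    (hF : F.IsHomogeneous d) (hd0 : d ≠ 0) (hd : d ≤ Fintype.card K)
    (hnoplane : ¬ ∃ a : Fin 4 → K, a ≠ 0 ∧ linForm a ∣ F)
    {W : Submodule K (Fin 4 → K)} (hW : Module.finrank K W = 3) :
    (linesInside (zeroPoints F) W).card ≤ d := by
  have hWF : ∃ v ∈ W, eval v F ≠ 0 := by
    by_contra! h
    obtain ⟨a, ha, hker⟩ := exists_ker_linMap_eq (U := W) (by rw [hW])
    exact hnoplane ⟨a, ha, linForm_dvd_of_vanishes hF hd ha fun v hv => h v (hker ▸ hv)⟩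
  refine card_hyperplanes_of_submodule_le hF hd W hWF _ fun U hU => ?_
  obtain ⟨hUW, hUl, hUF⟩ := mem_linesInside.1 hU
  exact ⟨hUW, by rw [hW, hUl], (ratPoints_subset_zeroPoints_iff hF hd0 U).1 hUF⟩

/-- Let `S` be a surface of degree `d` (`2 ≤ d ≤ q+1`) in `P^3` over
`F_q` without `F_q`-plane components attaining the elementary bound. Then every `F_q`-line
of `P^3` meets `S(F_q)` in exactly `0`, `1`, `d` or `q+1` points. -/
theorem line_meets_surface_in_0_1_d_or_all (K : Type) [Field K] [Fintype K]
    (d : ℕ) (F : MvPolynomial (Fin 4) K)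
    (hhom : F.IsHomogeneous d) (hsf : Squarefree F)
    (hnoplane : ¬ ∃ a : Fin 4 → K, a ≠ 0 ∧ linForm a ∣ F)
    (hd2 : 2 ≤ d) (hdq : d ≤ Fintype.card K + 1)
    (hN : Nat.card {p : Projectivization K (Fin 4 → K) // MvPolynomial.eval p.rep F = 0} =
      (d - 1) * Fintype.card K ^ 2 + d * Fintype.card K + 1) :
    ∀ l : Submodule K (Fin 4 → K), IsLine l →
      Nat.card {p : Projectivization K (Fin 4 → K) //
          p.rep ∈ l ∧ MvPolynomial.eval p.rep F = 0} = 0 ∨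
      Nat.card {p : Projectivization K (Fin 4 → K) //
          p.rep ∈ l ∧ MvPolynomial.eval p.rep F = 0} = 1 ∨
      Nat.card {p : Projectivization K (Fin 4 → K) //
          p.rep ∈ l ∧ MvPolynomial.eval p.rep F = 0} = d ∨
      Nat.card {p : Projectivization K (Fin 4 → K) //
          p.rep ∈ l ∧ MvPolynomial.eval p.rep F = 0} = Fintype.card K + 1 := by
  classical
  intro l hl
  have hZ : Nat.card {p : Projectivization K (Fin 4 → K) // eval p.rep F = 0} =
      (zeroPoints F).card := Nat.subtype_card _ fun p => mem_zeroPoints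
  have hZl : Nat.card {p : Projectivization K (Fin 4 → K) // p.rep ∈ l ∧ eval p.rep F = 0} =
      (zeroPoints F ∩ ratPoints l).card := Nat.subtype_card _ fun p => by
    rw [Finset.mem_inter, mem_zeroPoints, mem_ratPoints, and_comm]
  rw [hZ] at hN
  rw [hZl]
  obtain ⟨e, rfl⟩ : ∃ e, d = e + 1 := ⟨d - 1, by omega⟩
  rw [Nat.add_sub_cancel, ← Nat.card_eq_fintype_card] at hN
  rw [← Nat.card_eq_fintype_card] at hdq ⊢
  rcases hdq.eq_or_lt with h | h
  · have hsub : ratPoints ⊤ = zeroPoints F := by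
      refine (Finset.eq_of_subset_of_card_le (fun p _ => by simp [mem_ratPoints]) ?_).symm
      obtain rfl : e = Nat.card K := by omega
      rw [hN, card_ratPoints, finrank_top, Module.finrank_fin_fun]
      simp only [Finset.sum_range_succ, Finset.range_zero, Finset.sum_empty]
      apply le_of_eq
      ring
    rw [Finset.inter_eq_right.2 (hsub ▸ ratPoints_mono le_top), card_ratPoints_line hl]
    simp
  · have he : e + 1 ≤ Fintype.card K := by
      rw [← Nat.card_eq_fintype_card]
      omega
    exact card_inter_line_of_card
      (fun L hL hLF => card_zeroPoints_inter_line_le hhom e.succ_ne_zero he hL hLF)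
      (fun W hW => card_linesInside_zeroPoints_le hhom e.succ_ne_zero he hnoplane hW)
      (by omega) rfl hN hl
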